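/- arXiv:2012.07573 — 3 statements merged into one kernel-verified Lean document; each statement's English description precedes it below -/
import Mathlib

section
/- For every strict partition λ = (λ_1 > λ_2 > … > λ_ℓ > 0) of positive integers, the identity h(λ)^3 = (∏_{j=1}^ℓ ((2λ_j − 1)!!)^2) · h(λ) · h(2λ)^2 holds in the real numbers, where h(λ) = 2^{|λ| − ℓ/2} · (∏_{j=1}^ℓ 1/λ_j!) · ∏_{1 ≤ k < m ≤ ℓ} (λ_k − λ_m)/(λ_k + λ_m) and 2λ = (2λ_1 > … > 2λ_ℓ). Consequently, for any real ħ, (ħ/16)^{|λ|} h(λ)^3 / h(2λ)^2 = r_λ · h(λ), where r_λ = ∏_{j=1}^ℓ ∏_{i=1}^{λ_j} (ħ (2i−1)^2/16). -/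
open Finset

/-- Double factorial `(2n-1)!! = ∏_{i=1}^n (2i-1)`, with `(-1)!! = 1`. -/
def dfac (n : ℕ) : ℕ := ∏ i ∈ Finset.range n, (2 * i + 1)

/-- The principal specialization `h(λ) = Q_λ(δ_{k,1})` of the Schur Q-function,
given by Schur's hook-type formula. -/
noncomputable def hspec (ℓ : ℕ) (lam : Fin ℓ → ℕ) : ℝ :=
  (2 : ℝ) ^ ((∑ j, (lam j : ℝ)) - (ℓ : ℝ) / 2) *
  (∏ j, ((Nat.factorial (lam j) : ℝ))⁻¹) *
  ∏ p ∈ Finset.univ.filter (fun p : Fin ℓ × Fin ℓ => p.1 < p.2),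
    (((lam p.1 : ℝ) - (lam p.2 : ℝ)) / ((lam p.1 : ℝ) + (lam p.2 : ℝ)))

theorem factorial_two_mul_eq_dfac (n : ℕ) :
    Nat.factorial (2 * n) = 2 ^ n * Nat.factorial n * dfac n := by
  induction n with
  | zero => simp [dfac]
  | succ n ih =>
    have hd : dfac (n + 1) = dfac n * (2 * n + 1) := by
      simp [dfac, Finset.prod_range_succ]
    rw [show 2 * (n + 1) = 2 * n + 1 + 1 by ring, Nat.factorial_succ, Nat.factorial_succ, ih, hd,
      Nat.factorial_succ]
    ring

theorem dfac_pos (n : ℕ) : 0 < dfac n :=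
  Finset.prod_pos fun _ _ => by positivity

theorem dfac_mul_inv_factorial_two_mul (n : ℕ) :
    (dfac n : ℝ) * ((Nat.factorial (2 * n) : ℝ))⁻¹
      = ((2 : ℝ) ^ n)⁻¹ * ((Nat.factorial n : ℝ))⁻¹ := by
  have hd : (dfac n : ℝ) ≠ 0 := by exact_mod_cast (dfac_pos n).ne'
  have hf : (Nat.factorial n : ℝ) ≠ 0 := by exact_mod_cast Nat.factorial_ne_zero n
  rw [factorial_two_mul_eq_dfac]
  push_cast
  field_simp

theorem hspec_eq_prod_dfac_mul_hspec_two_mul (ℓ : ℕ) (lam : Fin ℓ → ℕ) :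
    hspec ℓ lam = (∏ j, (dfac (lam j) : ℝ)) * hspec ℓ (fun j => 2 * lam j) := by
  have hV : ∀ p : Fin ℓ × Fin ℓ,
      (((2 * lam p.1 : ℕ) : ℝ) - ((2 * lam p.2 : ℕ) : ℝ)) /
          (((2 * lam p.1 : ℕ) : ℝ) + ((2 * lam p.2 : ℕ) : ℝ))
        = ((lam p.1 : ℝ) - (lam p.2 : ℝ)) / ((lam p.1 : ℝ) + (lam p.2 : ℝ)) := fun p => by
    push_cast
    rw [← mul_sub, ← mul_add, mul_div_mul_left _ _ two_ne_zero]
  have hP : (∏ j, (dfac (lam j) : ℝ)) * ∏ j, ((Nat.factorial (2 * lam j) : ℝ))⁻¹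
      = ((2 : ℝ) ^ ∑ j, lam j)⁻¹ * ∏ j, ((Nat.factorial (lam j) : ℝ))⁻¹ := by
    rw [← Finset.prod_mul_distrib, Finset.prod_congr rfl
      fun j _ => dfac_mul_inv_factorial_two_mul (lam j), Finset.prod_mul_distrib,
      Finset.prod_inv_distrib, Finset.prod_pow_eq_pow_sum]
  have hE : (2 : ℝ) ^ ((∑ j, ((2 * lam j : ℕ) : ℝ)) - (ℓ : ℝ) / 2)
      = (2 : ℝ) ^ ((∑ j, (lam j : ℝ)) - (ℓ : ℝ) / 2) * (2 : ℝ) ^ ∑ j, lam j := by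
    rw [← Real.rpow_natCast, ← Real.rpow_add two_pos]
    push_cast
    rw [← Finset.mul_sum]
    ring_nf
  simp only [hspec, hV, hE]
  set V := ∏ p ∈ Finset.univ.filter (fun p : Fin ℓ × Fin ℓ => p.1 < p.2),
    (((lam p.1 : ℝ) - (lam p.2 : ℝ)) / ((lam p.1 : ℝ) + (lam p.2 : ℝ)))
  set E := (2 : ℝ) ^ ((∑ j, (lam j : ℝ)) - (ℓ : ℝ) / 2)
  have h2 : (2 : ℝ) ^ (∑ j, lam j) * ((2 : ℝ) ^ ∑ j, lam j)⁻¹ = 1 :=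
    mul_inv_cancel₀ (by positivity)
  linear_combination (-(E * (2 : ℝ) ^ (∑ j, lam j) * V)) * hP
    - E * (∏ j, ((Nat.factorial (lam j) : ℝ))⁻¹) * V * h2

theorem hspec_ne_zero {ℓ : ℕ} {lam : Fin ℓ → ℕ} (hpos : ∀ j, 0 < lam j) (hanti : StrictAnti lam) :
    hspec ℓ lam ≠ 0 := by
  refine mul_ne_zero (mul_ne_zero (by positivity) ?_) ?_
  · exact Finset.prod_ne_zero_iff.mpr fun j _ => by positivity
  · refine Finset.prod_ne_zero_iff.mpr fun p hp => ?_
    have hlt : (lam p.2 : ℝ) < lam p.1 := by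
      exact_mod_cast hanti (Finset.mem_filter.mp hp).2
    have h2 : (0 : ℝ) < lam p.2 := by exact_mod_cast hpos p.2
    exact div_ne_zero (by linarith) (by linarith)

theorem prod_range_mul_odd_sq_div (c : ℝ) (n : ℕ) :
    ∏ i ∈ Finset.range n, (c * ((2 * i + 1 : ℕ) : ℝ) ^ 2 / 16)
      = (c / 16) ^ n * (dfac n : ℝ) ^ 2 := by
  simp only [mul_div_right_comm]
  rw [Finset.prod_mul_distrib, Finset.prod_const, Finset.card_range, Finset.prod_pow, dfac,
    Nat.cast_prod]

/-- For every strict partition `λ`: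
`h(λ)^3 = (∏_j ((2λ_j-1)!!)^2) ⬝ h(λ) ⬝ h(2λ)^2`, and consequently for any real `ħ`,
`(ħ/16)^{|λ|} h(λ)^3 / h(2λ)^2 = r_λ ⬝ h(λ)` where
`r_λ = ∏_j ∏_{i=1}^{λ_j} (ħ (2i-1)^2 / 16)`. -/
theorem statement1 (ℓ : ℕ) (lam : Fin ℓ → ℕ) (hpos : ∀ j, 0 < lam j)
    (hanti : StrictAnti lam) (hbar : ℝ) :
    hspec ℓ lam ^ 3
        = (∏ j, ((dfac (lam j) : ℝ)) ^ 2) * hspec ℓ lam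
            * hspec ℓ (fun j => 2 * lam j) ^ 2
      ∧ (hbar / 16) ^ (∑ j, lam j) * hspec ℓ lam ^ 3 / hspec ℓ (fun j => 2 * lam j) ^ 2
        = (∏ j, ∏ i ∈ Finset.range (lam j), (hbar * ((2 * i + 1 : ℕ) : ℝ) ^ 2 / 16))
            * hspec ℓ lam := by
  have h := hspec_eq_prod_dfac_mul_hspec_two_mul ℓ lam
  have h2 : hspec ℓ (fun j => 2 * lam j) ≠ 0 :=
    hspec_ne_zero (fun j => Nat.mul_pos two_pos (hpos j))
      fun _ _ hij => Nat.mul_lt_mul_of_pos_left (hanti hij) two_pos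
  have h3 : hspec ℓ lam ^ 3 = (∏ j, ((dfac (lam j) : ℝ)) ^ 2) * hspec ℓ lam
      * hspec ℓ (fun j => 2 * lam j) ^ 2 := by
    rw [Finset.prod_pow, mul_right_comm, ← mul_pow, ← h]
    ring
  refine ⟨h3, ?_⟩
  rw [h3, ← mul_assoc, mul_div_cancel_right₀ _ (pow_ne_zero 2 h2)]
  simp only [prod_range_mul_odd_sq_div]
  rw [Finset.prod_mul_distrib, Finset.prod_pow_eq_pow_sum, mul_assoc]
end

section
/- Let σ be the ℝ-algebra endomorphism of R sending each variable t_k to t_k/2. Then for every real number N and every polynomial P in R, σ(W_0(N) P) = (1/4)·M_{-1}^B(σP) + (1/16 − N^2/4)·t_1·σP. In other words, conjugation of the generalized BGW cut-and-join operator W_0(N) by the rescaling t_k ↦ t_k/2 equals (1/4)M_{-1}^B + (1/16 − N^2/4)t_1, which exhibits W_0(N) (in rescaled times) as an element of the W^{(3)}-symmetry algebra of the BKP hierarchy plus a multiplication operator. -/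
open MvPolynomial

/-- `R` is the polynomial ring over `ℝ` in the variables `t_k`, `k` a positive odd
integer; the variable `X n` represents `t_{2n+1}`. -/
abbrev PR : Type := MvPolynomial ℕ ℝ

/-- The generalized BGW cut-and-join operator `W_0(N)`:
`W_0(N) P = Σ_{k,m odd ≥ 1} ( k m t_k t_m ∂_{k+m-1} P + (1/2)(k+m+1) t_{k+m+1} ∂_k ∂_m P )
 + (1/8 - N²/2) t_1 P`, written in the encoding `t_{2a+1} = X a`
(so `t_{k+m-1} = X (a+b)` and `t_{k+m+1} = X (a+b+1)` for `k = 2a+1`, `m = 2b+1`).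
The finitary sum `∑ᶠ` is well defined since only finitely many summands are nonzero. -/
noncomputable def W0 (N : ℝ) (P : PR) : PR :=
  (∑ᶠ (a : ℕ) (b : ℕ),
      ((((2 * a + 1) * (2 * b + 1) : ℕ) : ℝ) • (X a * X b * pderiv (a + b) P)
        + (((2 * a + 2 * b + 3 : ℕ) : ℝ) / 2) • (X (a + b + 1) * pderiv a (pderiv b P))))
  + (1 / 8 - N ^ 2 / 2) • (X 0 * P)

/-- The BKP `W^{(3)}`-generator `M_{-1}^B`:
`M_{-1}^B P = Σ_{k,m odd ≥ 1} ( 2 k m t_k t_m ∂_{k+m-1} P + 4(k+m+1) t_{k+m+1} ∂_k ∂_m P )`,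
in the same encoding `t_{2a+1} = X a`. -/
noncomputable def MB1 (P : PR) : PR :=
  ∑ᶠ (a : ℕ) (b : ℕ),
    (((2 * ((2 * a + 1) * (2 * b + 1)) : ℕ) : ℝ) • (X a * X b * pderiv (a + b) P)
      + (((4 * (2 * a + 2 * b + 3) : ℕ) : ℝ)) • (X (a + b + 1) * pderiv a (pderiv b P)))

/-- The `ℝ`-algebra endomorphism `σ` of `R` sending each variable `t_k` to `t_k/2`. -/
noncomputable def halfScale : PR →ₐ[ℝ] PR :=
  aeval (fun n => MvPolynomial.C (1 / 2 : ℝ) * X n)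

theorem halfScale_X (n : ℕ) : halfScale (X n) = (1 / 2 : ℝ) • X n := by
  simp [halfScale, smul_eq_C_mul]

theorem halfScale_injective : Function.Injective halfScale := by
  have h : (aeval (fun n => (2 : ℝ) • X n) : PR →ₐ[ℝ] PR).comp halfScale = AlgHom.id ℝ PR := by
    ext1 n
    simp [halfScale_X, smul_smul]
  refine Function.Injective.of_comp (f := (aeval (fun n => (2 : ℝ) • X n) : PR →ₐ[ℝ] PR)) ?_
  rw [← AlgHom.coe_comp, h]
  exact Function.injective_id

theorem pderiv_halfScale (k : ℕ) (P : PR) :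
    pderiv k (halfScale P) = (1 / 2 : ℝ) • halfScale (pderiv k P) := by
  induction P using MvPolynomial.induction_on with
  | C r => simp [halfScale]
  | add p q hp hq => simp only [map_add, hp, hq, smul_add]
  | mul_X p n hp =>
    simp only [map_mul, Derivation.leibniz, hp, halfScale_X, map_add, Derivation.map_smul,
      smul_eq_mul, pderiv_X]
    rcases eq_or_ne n k with rfl | h
    · simp only [Pi.single_eq_same, map_one, smul_eq_C_mul]
      ring
    · simp only [Pi.single_eq_of_ne' h.symm, map_zero, smul_eq_C_mul]
      ring

/-- Conjugating the generalized BGW cut-and-join operator `W_0(N)` by the rescaling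
`t_k ↦ t_k/2` gives `(1/4) M_{-1}^B + (1/16 - N²/4) t_1`. -/
theorem statement2 (N : ℝ) (P : PR) :
    halfScale (W0 N P)
      = (1 / 4 : ℝ) • MB1 (halfScale P)
        + (1 / 16 - N ^ 2 / 4) • (X 0 * halfScale P) := by
  have hX : halfScale (X 0 * P) = (1 / 2 : ℝ) • (X 0 * halfScale P) := by
    rw [map_mul, halfScale_X, smul_mul_assoc]
  have hinj : Function.Injective (halfScale : PR →+ PR) := halfScale_injective
  rw [W0, map_add, map_smul, hX, smul_smul, MB1, smul_finsum]
  congr 1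
  · refine ((halfScale : PR →+ PR).map_finsum_of_injective hinj _).trans ?_
    refine finsum_congr fun a => ?_
    rw [smul_finsum]
    refine ((halfScale : PR →+ PR).map_finsum_of_injective hinj _).trans ?_
    refine finsum_congr fun b => ?_
    simp only [AddMonoidHom.coe_coe, map_add, map_smul, map_mul, halfScale_X, pderiv_halfScale,
      Derivation.map_smul, smul_mul_assoc, mul_smul_comm, smul_smul, smul_add]
    congr 2 <;> push_cast <;> ring
  · congr 1
    ring
end

section
/- Suppose (τ_n)_{n≥0} is a sequence of polynomials in R with τ_0 = 1 which satisfies, for every n ≥ 0: (i) the dimension constraint L_0 τ_n = 3n·τ_n, and (ii) the Virasoro constraints: for every integer k ≥ −1, (1/2) L_{2k} τ_n − (1/2) ∂_{2k+3} τ_{n+1} + (δ_{k,0}/16) τ_n = 0. Then the sequence satisfies the cut-and-join recursion (n+1) τ_{n+1} = W_1 τ_n for all n ≥ 0. (This is the coefficient-wise form, in the expansion τ = Σ_n τ_n ħ^n, of the statement that the Heisenberg–Virasoro constraints for the Kontsevich–Witten tau-function imply the cut-and-join equation ∂τ/∂ħ = W_1 τ, and hence τ_{KW} = e^{ħ W_1}·1.)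 -/
open MvPolynomial

/-- The Kontsevich--Witten cut-and-join operator `W_1`:
`W_1 P = (1/3) Σ_{k,m odd ≥ 1, k+m ≥ 4} k m t_k t_m ∂_{k+m-3} P
 + (1/6) Σ_{k,m odd ≥ 1} (k+m+3) t_{k+m+3} ∂_k ∂_m P + (t_1³/6) P + (t_3/8) P`,
written in the encoding `t_{2a+1} = X a`. -/
noncomputable def W1 (P : PR) : PR :=
  (1 / 3 : ℝ) • (∑ᶠ (a : ℕ) (b : ℕ),
      if 1 ≤ a + b then
        ((((2 * a + 1) * (2 * b + 1) : ℕ) : ℝ) • (X a * X b * pderiv (a + b - 1) P))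
      else 0)
  + (1 / 6 : ℝ) • (∑ᶠ (a : ℕ) (b : ℕ),
      (((2 * a + 2 * b + 5 : ℕ) : ℝ)) • (X (a + b + 2) * pderiv a (pderiv b P)))
  + (1 / 6 : ℝ) • ((X 0) ^ 3 * P) + (1 / 8 : ℝ) • (X 1 * P)

/-- The Virasoro operator `L_{2k}` (for `k ≥ 0`) restricted to odd times:
`L_{2k} P = Σ_{a odd ≥ 1} a t_a ∂_{a+2k} P + (1/2) Σ_{a,b odd ≥ 1, a+b=2k} ∂_a ∂_b P`,
in the encoding `t_{2i+1} = X i`. -/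
noncomputable def Lop (k : ℕ) (P : PR) : PR :=
  (∑ᶠ i : ℕ, (((2 * i + 1 : ℕ) : ℝ)) • (X i * pderiv (i + k) P))
  + (1 / 2 : ℝ) • (∑ᶠ (i : ℕ) (j : ℕ),
      if i + j + 1 = k then pderiv i (pderiv j P) else 0)

/-- The Virasoro operator `L_{-2}` restricted to odd times:
`L_{-2} P = (1/2) t_1² P + Σ_{a odd ≥ 3} a t_a ∂_{a-2} P`,
in the encoding `t_{2i+1} = X i` (so `a = 2i+1 ≥ 3` reads `i ≥ 1`, `∂_{a-2} = ∂_{i-1}`). -/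
noncomputable def LopM2 (P : PR) : PR :=
  (1 / 2 : ℝ) • ((X 0) ^ 2 * P)
  + ∑ᶠ i : ℕ, if 1 ≤ i then (((2 * i + 1 : ℕ) : ℝ)) • (X i * pderiv (i - 1) P) else 0

theorem finsum_eq_sum_range {M : Type*} [AddCommMonoid M] (f : ℕ → M) (N : ℕ)
    (h : ∀ i, N ≤ i → f i = 0) : ∑ᶠ i, f i = ∑ i ∈ Finset.range N, f i := by
  apply finsum_eq_sum_of_support_subset
  intro i hi
  by_contra hN
  exact hi (h i (by simpa using hN))

theorem finsum_finsum_eq_sum_range {M : Type*} [AddCommMonoid M] (f : ℕ → ℕ → M) (N : ℕ)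
    (h : ∀ i j, N ≤ i ∨ N ≤ j → f i j = 0) :
    ∑ᶠ (i : ℕ) (j : ℕ), f i j = ∑ i ∈ Finset.range N, ∑ j ∈ Finset.range N, f i j := by
  have hrow : ∀ i, ∑ᶠ j, f i j = ∑ j ∈ Finset.range N, f i j := fun i =>
    finsum_eq_sum_range _ N fun j hj => h i j (Or.inr hj)
  simp_rw [hrow]
  exact finsum_eq_sum_range _ N fun i hi => Finset.sum_eq_zero fun j _ => h i j (Or.inl hi)

theorem MvPolynomial.pderiv_pderiv_comm {σ R : Type*} [CommRing R] (i j : σ)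
    (p : MvPolynomial σ R) : pderiv i (pderiv j p) = pderiv j (pderiv i p) := by
  have h : ⁅(pderiv i : Derivation R (MvPolynomial σ R) (MvPolynomial σ R)),
      (pderiv j : Derivation R (MvPolynomial σ R) (MvPolynomial σ R))⁆ = 0 := by
    classical
    refine derivation_ext fun k => ?_
    simp [Derivation.commutator_apply, pderiv_X, Pi.single_apply, apply_ite]
  have hp := DFunLike.congr_fun h p
  rwa [Derivation.commutator_apply, Derivation.coe_zero, Pi.zero_apply, sub_eq_zero] at hp

theorem MvPolynomial.exists_pderiv_eq_zero {R : Type*} [CommSemiring R] (p : MvPolynomial ℕ R) :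
    ∃ N, ∀ i, N ≤ i → pderiv i p = 0 := by
  refine ⟨p.vars.sup id + 1, fun i hi => pderiv_eq_zero_of_notMem_vars fun hmem => ?_⟩
  have : i ≤ p.vars.sup id := Finset.le_sup (f := id) hmem
  omega

section FiniteSums

variable {P : PR} {N : ℕ}

theorem Lop_eq_sum_range (hP : ∀ i, N ≤ i → pderiv i P = 0) {M : ℕ} (hM : N ≤ M) (k : ℕ) :
    Lop k P = ∑ i ∈ Finset.range M, ((2 * i + 1 : ℕ) : ℝ) • (X i * pderiv (i + k) P)
      + (1 / 2 : ℝ) • ∑ i ∈ Finset.range M, ∑ j ∈ Finset.range M,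
        if i + j + 1 = k then pderiv i (pderiv j P) else 0 := by
  rw [Lop, finsum_eq_sum_range _ M fun i hi => by rw [hP _ (by omega)]; simp,
    finsum_finsum_eq_sum_range _ M]
  rintro i j (h | h)
  · rw [pderiv_pderiv_comm, hP i (by omega)]; simp
  · rw [hP j (by omega)]; simp

theorem LopM2_eq_sum_range (hP : ∀ i, N ≤ i → pderiv i P = 0) {M : ℕ} (hM : N + 1 ≤ M) :
    LopM2 P = (1 / 2 : ℝ) • ((X 0) ^ 2 * P) + ∑ i ∈ Finset.range M,
      if 1 ≤ i then ((2 * i + 1 : ℕ) : ℝ) • (X i * pderiv (i - 1) P) else 0 := by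
  rw [LopM2, finsum_eq_sum_range _ M fun i hi => by rw [hP _ (by omega)]; simp]

theorem W1_eq_sum_range (hP : ∀ i, N ≤ i → pderiv i P = 0) {M : ℕ} (hM : N + 1 ≤ M) :
    W1 P = (1 / 3 : ℝ) • (∑ a ∈ Finset.range M, ∑ b ∈ Finset.range M,
        if 1 ≤ a + b then
          (((2 * a + 1) * (2 * b + 1) : ℕ) : ℝ) • (X a * X b * pderiv (a + b - 1) P)
        else 0)
      + (1 / 6 : ℝ) • (∑ a ∈ Finset.range M, ∑ b ∈ Finset.range M,
        ((2 * a + 2 * b + 5 : ℕ) : ℝ) • (X (a + b + 2) * pderiv a (pderiv b P)))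
      + (1 / 6 : ℝ) • ((X 0) ^ 3 * P) + (1 / 8 : ℝ) • (X 1 * P) := by
  rw [W1, finsum_finsum_eq_sum_range _ M fun i j h => by rw [hP _ (by omega)]; simp,
    finsum_finsum_eq_sum_range _ M]
  rintro i j (h | h)
  · rw [pderiv_pderiv_comm, hP i (by omega)]; simp
  · rw [hP j (by omega)]; simp

/-- Regrouping of the second-order part of `∑ k, (2 * k + 3) t_{2 * k + 3} L_{2 * k}`. -/
theorem sum_smul_X_mul_sum_pderiv_pderiv (hP : ∀ i, N ≤ i → pderiv i P = 0) {M K : ℕ}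
    (hK : 2 * N ≤ K) :
    ∑ k ∈ Finset.range K, ((2 * (k + 1) + 1 : ℕ) : ℝ) • (X (k + 1) *
        ∑ i ∈ Finset.range M, ∑ j ∈ Finset.range M,
          if i + j + 1 = k then pderiv i (pderiv j P) else 0)
      = ∑ i ∈ Finset.range M, ∑ j ∈ Finset.range M,
        ((2 * i + 2 * j + 5 : ℕ) : ℝ) • (X (i + j + 2) * pderiv i (pderiv j P)) := by
  simp_rw [Finset.mul_sum, Finset.smul_sum]
  rw [Finset.sum_comm]
  refine Finset.sum_congr rfl fun i _ => ?_
  rw [Finset.sum_comm]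
  refine Finset.sum_congr rfl fun j _ => ?_
  simp_rw [mul_ite, smul_ite, mul_zero, smul_zero]
  rw [Finset.sum_ite_eq]
  split_ifs with h
  · congr 2
    ring
  · have h' : N ≤ i ∨ N ≤ j := by
      rw [Finset.mem_range] at h
      omega
    rcases h' with h' | h'
    · rw [pderiv_pderiv_comm, hP i h']; simp
    · rw [hP j h']; simp

end FiniteSums

/-- If a sequence `(τ_n)` of polynomials with `τ_0 = 1` satisfies the dimension
constraint `L_0 τ_n = 3n τ_n` and the Virasoro constraints
`(1/2) L_{2k} τ_n - (1/2) ∂_{2k+3} τ_{n+1} + (δ_{k,0}/16) τ_n = 0` for all integers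
`k ≥ -1` (the case `k = -1` uses `L_{-2}` and `∂_1`; for `k ≥ 0`, `∂_{2k+3}` is the
variable of index `k+1`), then it satisfies the cut-and-join recursion
`(n+1) τ_{n+1} = W_1 τ_n`. (Coefficient-wise form of `∂τ/∂ħ = W_1 τ`, hence
`τ_KW = e^{ħ W_1} · 1`.) -/
theorem statement7 (τ : ℕ → PR) (h0 : τ 0 = 1)
    (hdim : ∀ n : ℕ, Lop 0 (τ n) = ((3 * n : ℕ) : ℝ) • τ n)
    (hvirM1 : ∀ n : ℕ,
      (1 / 2 : ℝ) • LopM2 (τ n) - (1 / 2 : ℝ) • pderiv 0 (τ (n + 1)) = 0)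
    (hvir : ∀ (n k : ℕ),
      (1 / 2 : ℝ) • Lop k (τ n) - (1 / 2 : ℝ) • pderiv (k + 1) (τ (n + 1))
        + (if k = 0 then (1 / 16 : ℝ) else 0) • τ n = 0) :
    ∀ n : ℕ, ((n : ℝ) + 1) • τ (n + 1) = W1 (τ n) := by
  intro n
  obtain ⟨N₁, hN₁⟩ := exists_pderiv_eq_zero (τ n)
  obtain ⟨N₂, hN₂⟩ := exists_pderiv_eq_zero (τ (n + 1))
  obtain ⟨N, hN₁N, hN₂N⟩ : ∃ N, N₁ ≤ N ∧ N₂ ≤ N := ⟨max N₁ N₂, by simp, by simp⟩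
  have hP : ∀ i, N ≤ i → pderiv i (τ n) = 0 := fun i hi => hN₁ i (hN₁N.trans hi)
  have hQ : ∀ i, N ≤ i → pderiv i (τ (n + 1)) = 0 := fun i hi => hN₂ i (hN₂N.trans hi)
  have hd0 : pderiv 0 (τ (n + 1)) = LopM2 (τ n) := by
    linear_combination (norm := module) (-2 : ℝ) • hvirM1 n
  have hdk : ∀ k, pderiv (k + 1) (τ (n + 1))
      = Lop k (τ n) + (if k = 0 then (1 / 8 : ℝ) else 0) • τ n := by
    intro k
    have h := hvir n k
    split_ifs at h ⊢ <;> linear_combination (norm := module) (-2 : ℝ) • h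
  have hE := hdim (n + 1)
  rw [Lop_eq_sum_range hQ (show N ≤ 2 * N + 1 + 1 by omega) 0, Finset.sum_range_succ'] at hE
  simp only [Nat.add_eq_zero_iff, one_ne_zero, and_false, if_false, Finset.sum_const_zero,
    smul_zero, add_zero] at hE
  have hδ : ∑ k ∈ Finset.range (2 * N + 1), ((2 * (k + 1) + 1 : ℕ) : ℝ) • (X (k + 1) *
      ((if k = 0 then (1 / 8 : ℝ) else 0) • τ n)) = (3 / 8 : ℝ) • (X 1 * τ n) := by
    rw [Finset.sum_range_succ']
    simp only [Nat.add_eq_zero_iff, one_ne_zero, and_false, if_false, zero_smul, mul_zero,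
      smul_zero, Finset.sum_const_zero, zero_add]
    simp only [if_true, mul_smul_comm, smul_smul]
    norm_num
  have hsummand : ∀ k, ((2 * (k + 1) + 1 : ℕ) : ℝ) • (X (k + 1) * pderiv (k + 1) (τ (n + 1)))
      = ((2 * (k + 1) + 1 : ℕ) : ℝ) • (X (k + 1) *
          ∑ i ∈ Finset.range (2 * N + 2), ((2 * i + 1 : ℕ) : ℝ) • (X i * pderiv (i + k) (τ n)))
        + (1 / 2 : ℝ) • (((2 * (k + 1) + 1 : ℕ) : ℝ) • (X (k + 1) *
          ∑ i ∈ Finset.range (2 * N + 2), ∑ j ∈ Finset.range (2 * N + 2),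
            if i + j + 1 = k then pderiv i (pderiv j (τ n)) else 0))
        + ((2 * (k + 1) + 1 : ℕ) : ℝ) • (X (k + 1) *
          ((if k = 0 then (1 / 8 : ℝ) else 0) • τ n)) := by
    intro k
    rw [hdk, Lop_eq_sum_range hP (show N ≤ 2 * N + 2 by omega), mul_add (X (k + 1)),
      mul_add (X (k + 1)), smul_add, smul_add, mul_smul_comm (1 / 2 : ℝ), smul_comm (1 / 2 : ℝ)]
  have hcube : (X 0 : PR) * X 0 ^ 2 = X 0 ^ 3 := by ring
  simp_rw [hsummand, Finset.sum_add_distrib, ← Finset.smul_sum] at hE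
  rw [hδ, hd0, LopM2_eq_sum_range hP (show N + 1 ≤ 2 * N + 2 by omega), mul_add (X 0),
    mul_smul_comm, ← mul_assoc, hcube] at hE
  have hquad : ∑ a ∈ Finset.range (2 * N + 1 + 1), ∑ b ∈ Finset.range (2 * N + 2),
        (if 1 ≤ a + b then
          (((2 * a + 1) * (2 * b + 1) : ℕ) : ℝ) • (X a * X b * pderiv (a + b - 1) (τ n))
        else 0)
      = ∑ k ∈ Finset.range (2 * N + 1), ((2 * (k + 1) + 1 : ℕ) : ℝ) • (X (k + 1) *
          ∑ i ∈ Finset.range (2 * N + 2), ((2 * i + 1 : ℕ) : ℝ) • (X i * pderiv (i + k) (τ n)))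
        + X 0 * ∑ i ∈ Finset.range (2 * N + 2),
          if 1 ≤ i then ((2 * i + 1 : ℕ) : ℝ) • (X i * pderiv (i - 1) (τ n)) else 0 := by
    rw [Finset.sum_range_succ']
    simp_rw [Finset.mul_sum, Finset.smul_sum]
    congr 1
    · refine Finset.sum_congr rfl fun k _ => Finset.sum_congr rfl fun i _ => ?_
      rw [if_pos (by omega), show k + 1 + i - 1 = i + k by omega, mul_smul_comm, smul_smul,
        Nat.cast_mul, mul_assoc]
    · refine Finset.sum_congr rfl fun i _ => ?_
      simp [mul_assoc]
  have hpair := sum_smul_X_mul_sum_pderiv_pderiv hP (M := 2 * N + 2)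
    (show 2 * N ≤ 2 * N + 1 by omega)
  rw [W1_eq_sum_range hP (show N + 1 ≤ 2 * N + 2 by omega), hquad, ← hpair]
  push_cast at hE ⊢
  linear_combination (norm := module) (-1 / 3 : ℝ) • hE
end
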